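/- (Matrix Khintchine inequality.) Let Λ₁,…,Λ_N be fixed D×D Hermitian matrices and let σ₁,…,σ_N be i.i.d. Rademacher random variables (uniform on {±1}). Then E_σ ‖ Σ_{k=1}^N σ_k Λ_k ‖ ≤ √(2 log(2D)) · ‖ Σ_{k=1}^N Λ_k² ‖^{1/2}, where ‖·‖ denotes the spectral (operator) norm. -/

import Mathlib

/-- The spectral (ℓ²-operator) norm of a square matrix. -/
noncomputable def specNorm {n : Type*} [Fintype n] [DecidableEq n] {𝕜 : Type*} [RCLike 𝕜]
    (A : Matrix n n 𝕜) : ℝ := ‖Matrix.toEuclideanCLM (𝕜 := 𝕜) A‖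

open Matrix in
lemma mk_pow {n : Type*} [Fintype n] [DecidableEq n] {W : Matrix n n ℂ} (hW : W.IsHermitian)
    (q : ℕ) : W ^ q = (hW.eigenvectorUnitary : Matrix n n ℂ) *
      diagonal (fun i => (((hW.eigenvalues i) ^ q : ℝ) : ℂ)) *
      star (hW.eigenvectorUnitary : Matrix n n ℂ) := by
  conv_lhs => rw [hW.spectral_theorem]
  rw [← map_pow, diagonal_pow, Unitary.conjStarAlgAut_apply]
  congr 3
  funext i
  simp

open Matrix in
lemma mk_trace {n : Type*} [Fintype n] [DecidableEq n] {W Y : Matrix n n ℂ} (hW : W.IsHermitian)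
    (hY : Y.IsHermitian) : ∃ c : n → n → ℝ, (∀ i j, 0 ≤ c i j) ∧
    ∀ q s : ℕ, (trace (W ^ q * Y ^ s)).re =
      ∑ i, ∑ j, c i j * (hW.eigenvalues i ^ q * hY.eigenvalues j ^ s) := by
  set U := (hW.eigenvectorUnitary : Matrix n n ℂ) with hU
  set V := (hY.eigenvectorUnitary : Matrix n n ℂ) with hV
  set Q := star U * V with hQ
  refine ⟨fun i j => Complex.normSq (Q i j), fun i j => Complex.normSq_nonneg _, fun q s => ?_⟩
  rw [mk_pow hW, mk_pow hY, ← hU, ← hV]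
  set d := diagonal (fun i => (((hW.eigenvalues i) ^ q : ℝ) : ℂ))
  set e := diagonal (fun i => (((hY.eigenvalues i) ^ s : ℝ) : ℂ))
  have : trace (U * d * star U * (V * e * star V)) = trace ((d * Q) * (e * star Q)) := by
    have h1 : U * d * star U * (V * e * star V) = U * (d * star U * (V * e * star V)) := by
      simp only [Matrix.mul_assoc]
    rw [h1, trace_mul_comm]
    congr 1
    simp only [hQ, star_mul, star_star, Matrix.mul_assoc]
  rw [this, trace]
  simp only [diag_apply]
  simp only [mul_apply (M := d * Q), Complex.re_sum]
  simp only [d, e, diagonal_mul, star_apply]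
  refine Finset.sum_congr rfl fun i _ => Finset.sum_congr rfl fun j _ => ?_
  have : ∀ (a b : ℝ) (z : ℂ), ((a : ℂ) * z * (b * star z)).re = Complex.normSq z * (a * b) := by
    intro a b z
    have : (a : ℂ) * z * (b * star z) = ((Complex.normSq z * (a * b) : ℝ) : ℂ) := by
      have := Complex.mul_conj z
      simp only [Complex.star_def]
      push_cast
      rw [← this]; ring
    rw [this, Complex.ofReal_re]
  exact this _ _ _

lemma mk_scalar (a b : ℝ) (p : ℕ) :
    (a - b) * (a ^ (2 * p + 1) - b ^ (2 * p + 1)) ≤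
      ((2 * p + 1 : ℝ) / 2) * ((a - b) ^ 2 * (a ^ (2 * p) + b ^ (2 * p))) := by
  have hg := Commute.geom_sum₂_mul (Commute.all a b) (2 * p + 1)
  have key : ∀ q ∈ Finset.range (2 * p + 1),
      a ^ q * b ^ (2 * p - q) + a ^ (2 * p - q) * b ^ q ≤ a ^ (2 * p) + b ^ (2 * p) := by
    intro q hq
    have hq' : q ≤ 2 * p := by simpa [Nat.lt_succ_iff] using hq
    obtain ⟨r, hr⟩ := Nat.exists_eq_add_of_le hq'
    have h2 : 2 * p - q = r := by omega
    rw [h2]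
    have ha : a ^ (2 * p) = |a| ^ q * |a| ^ r := by
      rw [← pow_add, ← hr, pow_mul, pow_mul, sq_abs]
    have hb : b ^ (2 * p) = |b| ^ q * |b| ^ r := by
      rw [← pow_add, ← hr, pow_mul, pow_mul, sq_abs]
    rw [ha, hb]
    have h3 : a ^ q * b ^ r ≤ |a| ^ q * |b| ^ r := by
      rw [← abs_pow, ← abs_pow, ← abs_mul]; exact le_abs_self _
    have h4 : a ^ r * b ^ q ≤ |a| ^ r * |b| ^ q := by
      rw [← abs_pow, ← abs_pow, ← abs_mul]; exact le_abs_self _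
    have h5 : 0 ≤ (|a| ^ q - |b| ^ q) * (|a| ^ r - |b| ^ r) := by
      rcases le_total |a| |b| with h | h
      · exact mul_nonneg_of_nonpos_of_nonpos
          (sub_nonpos.2 (pow_le_pow_left₀ (abs_nonneg _) h _))
          (sub_nonpos.2 (pow_le_pow_left₀ (abs_nonneg _) h _))
      · exact mul_nonneg
          (sub_nonneg.2 (pow_le_pow_left₀ (abs_nonneg _) h _))
          (sub_nonneg.2 (pow_le_pow_left₀ (abs_nonneg _) h _))
    nlinarith
  have hs := Finset.sum_le_sum key
  have hrefl : ∑ q ∈ Finset.range (2 * p + 1), a ^ (2 * p - q) * b ^ q =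
      ∑ q ∈ Finset.range (2 * p + 1), a ^ q * b ^ (2 * p - q) := by
    rw [← Finset.sum_range_reflect]
    refine Finset.sum_congr rfl fun q hq => ?_
    have hq' : q ≤ 2 * p := by simpa [Nat.lt_succ_iff] using hq
    congr 2 <;> omega
  rw [Finset.sum_add_distrib, hrefl] at hs
  simp only [Finset.sum_const, Finset.card_range, nsmul_eq_mul] at hs
  simp only [Nat.add_sub_cancel] at hg
  have e1 : ∑ q ∈ Finset.range (2 * p + 1), a ^ q * b ^ (2 * p + 1 - 1 - q) =
    ∑ q ∈ Finset.range (2 * p + 1), a ^ q * b ^ (2 * p - q) := rfl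
  rw [← hg]
  push_cast at hs
  nlinarith [mul_le_mul_of_nonneg_left hs (sq_nonneg (a - b))]

open Matrix in
lemma mk_gm {n : Type*} [Fintype n] [DecidableEq n] {W Y : Matrix n n ℂ} (hW : W.IsHermitian)
    (hY : Y.IsHermitian) (p : ℕ) :
    (trace ((W - Y) * (W ^ (2 * p + 1) - Y ^ (2 * p + 1)))).re ≤
      ((2 * p + 1 : ℝ) / 2) * (trace ((W - Y) ^ 2 * (W ^ (2 * p) + Y ^ (2 * p)))).re := by
  obtain ⟨c, hc, h⟩ := mk_trace hW hY
  have L : trace ((W - Y) * (W ^ (2 * p + 1) - Y ^ (2 * p + 1))) =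
      trace (W ^ (2 * p + 2) * Y ^ 0) - trace (W ^ 1 * Y ^ (2 * p + 1))
        - trace (W ^ (2 * p + 1) * Y ^ 1) + trace (W ^ 0 * Y ^ (2 * p + 2)) := by
    rw [trace_mul_comm (W ^ (2 * p + 1)) (Y ^ 1)]
    simp only [pow_zero, pow_one, mul_one, one_mul, sub_mul, mul_sub, trace_sub, ← pow_succ']
    ring
  have R : trace ((W - Y) ^ 2 * (W ^ (2 * p) + Y ^ (2 * p))) =
      trace (W ^ (2 * p + 2) * Y ^ 0) - 2 * trace (W ^ (2 * p + 1) * Y ^ 1)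
       + trace (W ^ (2 * p) * Y ^ 2) + trace (W ^ 2 * Y ^ (2 * p))
       - 2 * trace (W ^ 1 * Y ^ (2 * p + 1)) + trace (W ^ 0 * Y ^ (2 * p + 2)) := by
    have t1 : trace (W * Y * W ^ (2 * p)) = trace (W ^ (2 * p + 1) * Y ^ 1) := by
      rw [trace_mul_comm, ← Matrix.mul_assoc, ← pow_succ, pow_one]
    have t2 : trace (Y * W * W ^ (2 * p)) = trace (W ^ (2 * p + 1) * Y ^ 1) := by
      rw [Matrix.mul_assoc, ← pow_succ', trace_mul_comm, pow_one]
    have t3 : trace (W * Y * Y ^ (2 * p)) = trace (W ^ 1 * Y ^ (2 * p + 1)) := by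
      rw [Matrix.mul_assoc, ← pow_succ', pow_one]
    have t4 : trace (Y * W * Y ^ (2 * p)) = trace (W ^ 1 * Y ^ (2 * p + 1)) := by
      rw [Matrix.mul_assoc, trace_mul_comm, Matrix.mul_assoc, ← pow_succ, pow_one]
    have t5 : trace (Y * Y * W ^ (2 * p)) = trace (W ^ (2 * p) * Y ^ 2) := by
      rw [trace_mul_comm, ← pow_two]
    have t6 : trace (W * W * Y ^ (2 * p)) = trace (W ^ 2 * Y ^ (2 * p)) := by
      rw [← pow_two]
    have t7 : trace (W * W * W ^ (2 * p)) = trace (W ^ (2 * p + 2) * Y ^ 0) := by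
      rw [← pow_two, ← pow_add, pow_zero, mul_one, add_comm]
    have t8 : trace (Y * Y * Y ^ (2 * p)) = trace (W ^ 0 * Y ^ (2 * p + 2)) := by
      rw [← pow_two, ← pow_add, pow_zero, one_mul, add_comm]
    rw [pow_two]
    simp only [sub_mul, mul_sub, mul_add, trace_sub, trace_add, t1, t2, t3, t4, t5, t6, t7, t8]
    ring
  rw [L, R]
  have two : ∀ z : ℂ, (2 * z).re = 2 * z.re := fun z => by simp
  simp only [Complex.add_re, Complex.sub_re, two, h]
  simp only [Finset.mul_sum, ← Finset.sum_add_distrib, ← Finset.sum_sub_distrib]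
  refine Finset.sum_le_sum fun i _ => Finset.sum_le_sum fun j _ => ?_
  have := mul_le_mul_of_nonneg_left
    (mk_scalar (hW.eigenvalues i) (hY.eigenvalues j) p) (hc i j)
  refine (le_of_eq ?_).trans (this.trans (le_of_eq ?_)) <;> ring

open Matrix Matrix.Norms.L2Operator in
lemma mk_norm {n : Type*} [Fintype n] [DecidableEq n] {W : Matrix n n ℂ} (hW : W.IsHermitian) :
    specNorm W = ‖hW.eigenvalues‖ := by
  unfold specNorm
  rw [l2_opNorm_toEuclideanCLM]
  conv_lhs => rw [hW.spectral_theorem]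
  rw [Unitary.conjStarAlgAut_apply, ← Unitary.coe_star, CStarRing.norm_mul_coe_unitary, CStarRing.norm_coe_unitary_mul,
    l2_opNorm_diagonal]
  simp [Pi.norm_def]

open Matrix in
lemma mk_bound {n : Type*} [Fintype n] [DecidableEq n] {S X : Matrix n n ℂ} (hS : S.IsHermitian)
    (hX : X.IsHermitian) (p : ℕ) :
    (trace (S * X ^ (2 * p))).re ≤ specNorm S * (trace (X ^ (2 * p))).re := by
  obtain ⟨c, hc, h⟩ := mk_trace hS hX
  have h1 := h 1 (2 * p)
  have h0 := h 0 (2 * p)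
  rw [pow_one] at h1
  rw [pow_zero, one_mul] at h0
  rw [h1, h0]
  simp only [Finset.mul_sum]
  refine Finset.sum_le_sum fun i _ => Finset.sum_le_sum fun j _ => ?_
  have h2 : hS.eigenvalues i ≤ specNorm S := by
    rw [mk_norm hS]
    exact (le_abs_self _).trans (norm_le_pi_norm hS.eigenvalues i)
  have h3 : 0 ≤ c i j * hX.eigenvalues j ^ (2 * p) :=
    mul_nonneg (hc i j) (by rw [pow_mul]; positivity)
  have := mul_le_mul_of_nonneg_right h2 h3
  refine (le_of_eq ?_).trans (this.trans (le_of_eq ?_)) <;> ring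

/-- sign -/
noncomputable def mkS (b : Bool) : ℝ := if b then (1 : ℝ) else -1

/-- random sum -/
noncomputable def mkX {D N : ℕ} (Λ : Fin N → Matrix (Fin D) (Fin D) ℂ) (σ : Fin N → Bool) :
    Matrix (Fin D) (Fin D) ℂ := ∑ k, mkS (σ k) • Λ k

lemma mkX_herm {D N : ℕ} (Λ : Fin N → Matrix (Fin D) (Fin D) ℂ)
    (hHerm : ∀ k, (Λ k).IsHermitian) (σ : Fin N → Bool) : (mkX Λ σ).IsHermitian := by
  unfold mkX Matrix.IsHermitian
  rw [Matrix.conjTranspose_sum]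
  refine Finset.sum_congr rfl fun k _ => ?_
  rw [Matrix.conjTranspose_smul, (hHerm k).eq, star_trivial]

/-- flip of a coordinate -/
def mkF {N : ℕ} (k : Fin N) (σ : Fin N → Bool) : Fin N → Bool := Function.update σ k (!σ k)

lemma mkF_invol {N : ℕ} (k : Fin N) : Function.Involutive (mkF k) := by
  intro σ
  unfold mkF
  simp

lemma mkS_not (b : Bool) : mkS (!b) = - mkS b := by cases b <;> simp [mkS]

lemma mkS_sq (b : Bool) : mkS b * mkS b = 1 := by cases b <;> simp [mkS]

lemma mkX_flip {D N : ℕ} (Λ : Fin N → Matrix (Fin D) (Fin D) ℂ) (k : Fin N) (σ : Fin N → Bool) :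
    mkX Λ σ - mkX Λ (mkF k σ) = (2 * mkS (σ k)) • Λ k := by
  unfold mkX
  rw [← Finset.sum_sub_distrib, Finset.sum_eq_single k]
  · simp only [mkF, Function.update_self, mkS_not]
    rw [← sub_smul]; congr 1; ring
  · intro b _ hb
    simp [mkF, Function.update_of_ne hb]
  · simp

open Matrix in
lemma mk_step {D N : ℕ} (Λ : Fin N → Matrix (Fin D) (Fin D) ℂ)
    (hHerm : ∀ k, (Λ k).IsHermitian) (p : ℕ) (k : Fin N) :
    ∑ σ, (trace (mkS (σ k) • Λ k * mkX Λ σ ^ (2 * p + 1))).re ≤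
      (2 * p + 1) * ∑ σ, (trace (Λ k ^ 2 * mkX Λ σ ^ (2 * p))).re := by
  have inv : ∀ g : (Fin N → Bool) → ℝ, ∑ σ, g (mkF k σ) = ∑ σ, g σ := fun g =>
    Equiv.sum_comp (mkF_invol k).toPerm g
  have sm : ∀ (r : ℝ) (A B : Matrix (Fin D) (Fin D) ℂ),
      (trace (r • A * B)).re = r * (trace (A * B)).re := by
    intro r A B; rw [smul_mul_assoc, trace_smul]; simp
  have key : ∀ σ, (trace (mkS (σ k) • Λ k * mkX Λ σ ^ (2 * p + 1))).re
      + (trace (mkS (mkF k σ k) • Λ k * mkX Λ (mkF k σ) ^ (2 * p + 1))).re ≤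
      (2 * p + 1) * ((trace (Λ k ^ 2 * mkX Λ σ ^ (2 * p))).re
        + (trace (Λ k ^ 2 * mkX Λ (mkF k σ) ^ (2 * p))).re) := by
    intro σ
    have h := mk_gm (mkX_herm Λ hHerm σ) (mkX_herm Λ hHerm (mkF k σ)) p
    rw [mkX_flip, smul_pow, sm, sm, mul_sub, mul_add, trace_sub, trace_add, Complex.sub_re,
      Complex.add_re] at h
    have hf : mkF k σ k = !σ k := by simp [mkF]
    rw [hf, mkS_not, sm, sm]
    have h2 : (2 * mkS (σ k)) ^ 2 = 4 := by have := mkS_sq (σ k); nlinarith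
    rw [h2] at h
    linarith
  have i1 := inv (fun σ => (trace (mkS (σ k) • Λ k * mkX Λ σ ^ (2 * p + 1))).re)
  have i2 := inv (fun σ => (trace (Λ k ^ 2 * mkX Λ σ ^ (2 * p))).re)
  have := Finset.sum_le_sum (s := Finset.univ) fun σ _ => key σ
  rw [← Finset.mul_sum, Finset.sum_add_distrib, Finset.sum_add_distrib,
    i1, i2] at this
  linarith

open Matrix in
lemma mk_moment_step {D N : ℕ} (Λ : Fin N → Matrix (Fin D) (Fin D) ℂ)
    (hHerm : ∀ k, (Λ k).IsHermitian) (p : ℕ) :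
    ∑ σ, (trace (mkX Λ σ ^ (2 * (p + 1)))).re ≤
      (2 * p + 1) * (specNorm (∑ k, Λ k ^ 2) * ∑ σ, (trace (mkX Λ σ ^ (2 * p))).re) := by
  have e : ∀ σ, (trace (mkX Λ σ ^ (2 * (p + 1)))).re =
      ∑ k, (trace (mkS (σ k) • Λ k * mkX Λ σ ^ (2 * p + 1))).re := by
    intro σ
    rw [← Complex.re_sum, ← trace_sum, ← Finset.sum_mul, show 2 * (p + 1) = (2 * p + 1) + 1 by ring,
      pow_succ']
    rfl
  simp only [e]
  rw [Finset.sum_comm]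
  refine (Finset.sum_le_sum fun k _ => mk_step Λ hHerm p k).trans ?_
  rw [← Finset.mul_sum, Finset.sum_comm]
  have hS : (∑ k, Λ k ^ 2).IsHermitian := by
    unfold Matrix.IsHermitian
    rw [Matrix.conjTranspose_sum]
    refine Finset.sum_congr rfl fun k _ => ?_
    rw [Matrix.conjTranspose_pow, (hHerm k).eq]
  refine mul_le_mul_of_nonneg_left ?_ (by positivity)
  rw [Finset.mul_sum]
  refine Finset.sum_le_sum fun σ _ => ?_
  rw [← Complex.re_sum, ← trace_sum, ← Finset.sum_mul]
  exact mk_bound hS (mkX_herm Λ hHerm σ) p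

lemma mk_specNorm_nonneg {D : ℕ} (A : Matrix (Fin D) (Fin D) ℂ) : 0 ≤ specNorm A := norm_nonneg _

open Matrix in
lemma mk_moment {D N : ℕ} (Λ : Fin N → Matrix (Fin D) (Fin D) ℂ)
    (hHerm : ∀ k, (Λ k).IsHermitian) (p : ℕ) :
    (∑ σ, (trace (mkX Λ σ ^ (2 * p))).re) / ((2 * p).factorial : ℝ) ≤
      2 ^ N * D * ((specNorm (∑ k, Λ k ^ 2) / 2) ^ p / (p.factorial : ℝ)) := by
  induction p with
  | zero => simp
  | succ p ih =>
    have h := mk_moment_step Λ hHerm p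
    set v := specNorm (∑ k, Λ k ^ 2)
    have hv : 0 ≤ v := mk_specNorm_nonneg _
    set M := ∑ σ, (trace (mkX Λ σ ^ (2 * p))).re
    rw [show (2 * (p + 1)).factorial = (2 * p + 2) * ((2 * p + 1) * (2 * p).factorial) from rfl,
      Nat.factorial_succ]
    push_cast
    have hf : (0 : ℝ) < ((2 * p).factorial : ℝ) := by positivity
    have hg : (0 : ℝ) < (p.factorial : ℝ) := by positivity
    calc _ ≤ ((2 * p + 1) * (v * M)) / ((2 * p + 2) * ((2 * p + 1) * (2 * p).factorial) : ℝ) := by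
          gcongr
      _ = v / (2 * (p + 1)) * (M / (2 * p).factorial) := by field_simp
      _ ≤ v / (2 * (p + 1)) * (2 ^ N * D * ((v / 2) ^ p / (p.factorial : ℝ))) := by gcongr
      _ = _ := by rw [pow_succ]; field_simp

lemma mk_hasSum (x : ℝ) : HasSum (fun p : ℕ => x ^ p / (p.factorial : ℝ)) (Real.exp x) := by
  rw [Real.exp_eq_exp_ℝ]
  exact NormedSpace.expSeries_div_hasSum_exp x

open Matrix in
lemma mk_exp {D N : ℕ} (hD : 0 < D) (Λ : Fin N → Matrix (Fin D) (Fin D) ℂ)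
    (hHerm : ∀ k, (Λ k).IsHermitian) (θ : ℝ) :
    ∑ σ, Real.exp (θ * specNorm (mkX Λ σ)) ≤
      2 ^ N * (2 * D) * Real.exp (θ ^ 2 * specNorm (∑ k, Λ k ^ 2) / 2) := by
  set v := specNorm (∑ k, Λ k ^ 2)
  have tr : ∀ σ p, (trace (mkX Λ σ ^ p)).re =
      ∑ i, (mkX_herm Λ hHerm σ).eigenvalues i ^ p := by
    intro σ p
    rw [mk_pow (mkX_herm Λ hHerm σ), trace_mul_comm, ← Matrix.mul_assoc,
      Unitary.coe_star_mul_self, one_mul, trace_diagonal, Complex.re_sum]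
    simp only [Complex.ofReal_re]
  have h1 : ∀ σ, Real.exp (θ * specNorm (mkX Λ σ)) ≤
      2 * ∑ i, Real.cosh (θ * (mkX_herm Λ hHerm σ).eigenvalues i) := by
    intro σ
    have : Nonempty (Fin D) := ⟨⟨0, hD⟩⟩
    set l := (mkX_herm Λ hHerm σ).eigenvalues with hl
    obtain ⟨i, -, hi⟩ := Finset.exists_max_image Finset.univ (fun i => |l i|) Finset.univ_nonempty
    have hn : specNorm (mkX Λ σ) = |l i| := by
      rw [mk_norm (mkX_herm Λ hHerm σ)]
      apply le_antisymm
      · exact (pi_norm_le_iff_of_nonneg (abs_nonneg _)).2 fun j => hi j (Finset.mem_univ _)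
      · exact norm_le_pi_norm l i
    rw [hn]
    have h2 : Real.cosh (θ * l i) ≤ ∑ i, Real.cosh (θ * l i) :=
      Finset.single_le_sum (f := fun i => Real.cosh (θ * l i))
        (fun j _ => (Real.cosh_pos _).le) (Finset.mem_univ i)
    have h3 : Real.cosh (θ * l i) = Real.cosh (θ * |l i|) := by
      rw [← Real.cosh_abs, ← Real.cosh_abs (θ * |l i|), abs_mul, abs_mul, abs_abs]
    have h4 := Real.cosh_eq (θ * |l i|)
    have h5 := Real.exp_pos (-(θ * |l i|))
    linarith
  have hm0 := mk_moment Λ hHerm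
  rw [show specNorm (∑ k, Λ k ^ 2) = v from rfl] at hm0
  simp only [tr] at hm0
  clear tr
  generalize hl : (fun σ => (mkX_herm Λ hHerm σ).eigenvalues) = l at *
  have hl' : ∀ σ i, (mkX_herm Λ hHerm σ).eigenvalues i = l σ i := fun σ i => by rw [← hl]
  simp only [hl'] at h1 hm0
  clear hl hl'
  clear_value v
  have hs1 : HasSum (fun p : ℕ => ∑ σ, ∑ i,
      (θ * l σ i) ^ (2 * p) / ((2 * p).factorial : ℝ))
      (∑ σ, ∑ i, Real.cosh (θ * l σ i)) :=
    hasSum_sum fun σ _ => hasSum_sum fun i _ => Real.hasSum_cosh _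
  have hs2 : HasSum (fun p : ℕ => 2 ^ N * D * ((θ ^ 2 * v / 2) ^ p / (p.factorial : ℝ)))
      (2 ^ N * D * Real.exp (θ ^ 2 * v / 2)) := by
    have := mk_hasSum (θ ^ 2 * v / 2)
    exact HasSum.mul_left (2 ^ N * (D : ℝ)) this
  have hle := hasSum_le (fun p => ?_) hs1 hs2
  · calc _ ≤ ∑ σ, 2 * ∑ i, Real.cosh (θ * l σ i) :=
          Finset.sum_le_sum fun σ _ => h1 σ
      _ = 2 * ∑ σ, ∑ i, Real.cosh (θ * l σ i) := by
          rw [Finset.mul_sum]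
      _ ≤ 2 * (2 ^ N * D * Real.exp (θ ^ 2 * v / 2)) := mul_le_mul_of_nonneg_left hle zero_le_two
      _ = _ := by ring
  · have hm := mul_le_mul_of_nonneg_left (hm0 p)
      (show 0 ≤ (θ ^ 2) ^ p by positivity)
    refine (le_of_eq ?_).trans (hm.trans (le_of_eq ?_))
    · simp only [Finset.sum_div, Finset.mul_sum]
      refine Finset.sum_congr rfl fun σ _ => Finset.sum_congr rfl fun i _ => ?_
      rw [mul_pow, pow_mul θ]; ring
    · rw [mul_div_assoc, mul_pow]; ring

/-- **Matrix Khintchine inequality.** For fixed Hermitian matrices `Λ₁,…,Λ_N` and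
i.i.d. Rademacher signs `σ`, `E_σ ‖Σ σ_k Λ_k‖ ≤ √(2 log(2D)) ‖Σ Λ_k²‖^{1/2}`. -/
theorem matrix_khintchine
    {D N : ℕ} (Λ : Fin N → Matrix (Fin D) (Fin D) ℂ) (hHerm : ∀ k, (Λ k).IsHermitian) :
    (2 ^ N : ℝ)⁻¹ * ∑ σ : Fin N → Bool,
        specNorm (∑ k, (if σ k then (1 : ℝ) else -1) • Λ k) ≤
      Real.sqrt (2 * Real.log (2 * D)) * Real.sqrt (specNorm (∑ k, Λ k ^ 2)) := by
  rcases Nat.eq_zero_or_pos D with hD | hD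
  · subst hD
    have : ∀ A : Matrix (Fin 0) (Fin 0) ℂ, specNorm A = 0 := by
      intro A
      rw [Subsingleton.elim A 0]
      simp [specNorm]
    simp [this]
  change (2 ^ N : ℝ)⁻¹ * ∑ σ : Fin N → Bool, specNorm (mkX Λ σ) ≤ _
  set E := (2 ^ N : ℝ)⁻¹ * ∑ σ : Fin N → Bool, specNorm (mkX Λ σ) with hE
  set v := specNorm (∑ k, Λ k ^ 2) with hv
  set L := Real.log (2 * D) with hL
  have hv0 : 0 ≤ v := mk_specNorm_nonneg _
  have hD1 : (1 : ℝ) ≤ D := by exact_mod_cast hD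
  have hL0 : 0 < L := Real.log_pos (by linarith)
  have hE0 : 0 ≤ E := mul_nonneg (by positivity)
    (Finset.sum_nonneg fun σ _ => mk_specNorm_nonneg _)
  have main : ∀ θ : ℝ, θ * E ≤ L + θ ^ 2 * v / 2 := by
    intro θ
    have h := mk_exp hD Λ hHerm θ
    rw [← hv] at h
    set c := L + θ ^ 2 * v / 2 with hc
    have hexpc : Real.exp c = 2 * D * Real.exp (θ ^ 2 * v / 2) := by
      rw [hc, Real.exp_add, hL, Real.exp_log (by linarith)]
    have h1 : ∀ σ, θ * specNorm (mkX Λ σ) ≤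
        Real.exp (θ * specNorm (mkX Λ σ)) * Real.exp (-c) + (c - 1) := by
      intro σ
      have := Real.add_one_le_exp (θ * specNorm (mkX Λ σ) + -c)
      rw [Real.exp_add] at this
      linarith
    have h2 := Finset.sum_le_sum (s := Finset.univ) fun σ _ => h1 σ
    rw [← Finset.mul_sum, Finset.sum_add_distrib, ← Finset.sum_mul] at h2
    have hcard : ∑ σ : Fin N → Bool, (c - 1) = 2 ^ N * (c - 1) := by simp; ring
    rw [hcard] at h2
    have h3 : (∑ σ, Real.exp (θ * specNorm (mkX Λ σ))) * Real.exp (-c) ≤ 2 ^ N := by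
      calc _ ≤ (2 ^ N * (2 * D) * Real.exp (θ ^ 2 * v / 2)) * Real.exp (-c) := by gcongr
        _ = 2 ^ N * (Real.exp c * Real.exp (-c)) := by rw [hexpc]; ring
        _ = 2 ^ N := by rw [← Real.exp_add]; simp
    have h4 : θ * ∑ σ, specNorm (mkX Λ σ) ≤ 2 ^ N * c := by linarith
    have h5 := mul_le_mul_of_nonneg_left h4 (show (0 : ℝ) ≤ (2 ^ N)⁻¹ by positivity)
    rw [← mul_assoc (_⁻¹) (2 ^ N), inv_mul_cancel₀ (by positivity), one_mul] at h5
    calc θ * E = (2 ^ N)⁻¹ * (θ * ∑ σ, specNorm (mkX Λ σ)) := by rw [hE]; ring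
      _ ≤ c := h5
  rw [← Real.sqrt_mul (by linarith)]
  apply Real.le_sqrt_of_sq_le
  rcases hv0.eq_or_lt with h0 | h0
  · rw [← h0] at main ⊢
    rcases hE0.eq_or_lt with h1 | h1
    · rw [← h1]; simp
    · exfalso
      have := main (2 * L / E)
      rw [div_mul_cancel₀ _ h1.ne'] at this
      linarith
  · have := main (E / v)
    have h2 : E / v * E - (E / v) ^ 2 * v / 2 = E ^ 2 / (2 * v) := by field_simp; ring
    have h3 : E ^ 2 / (2 * v) ≤ L := by linarith
    rw [div_le_iff₀ (by linarith)] at h3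
    linarith
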